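/- Let Γ ⊂ P^n be a nondegenerate finite subscheme of degree d over an algebraically closed field of characteristic 0 with t(Γ) ≤ n−1 and ⌈(d−n−1)/(t(Γ)+1)⌉ + 3 ≤ reg(Γ) ≤ ⌈(d−n−1)/t(Γ)⌉ + 2. Then Γ admits a regularity preserving hyperplane section: there exists a hyperplane H ≅ P^{n−1} such that Γ ∩ H is a nondegenerate subscheme of H and reg(Γ ∩ H) = reg(Γ). -/

import Mathlib

open MvPolynomial Filter
open scoped Classical

attribute [local instance] MvPolynomial.gradedAlgebra

noncomputable section

variable {K : Type} [Field K] {n : ℕ}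

/-- The Hilbert function, in degree `m`, of the quotient of the homogeneous
coordinate ring of `ℙ^n_K` by the ideal `I`. -/
def hilbF (I : Ideal (MvPolynomial (Fin (n+1)) K)) (m : ℕ) : ℕ :=
  Module.finrank K
    ((MvPolynomial.homogeneousSubmodule (Fin (n+1)) K m).map
      (Ideal.Quotient.mkₐ K I).toLinearMap)

/-- The irrelevant maximal ideal `(x_0, …, x_n)`. -/
def irrelevantIdeal (K : Type) [Field K] (n : ℕ) : Ideal (MvPolynomial (Fin (n+1)) K) :=
  Ideal.span (Set.range MvPolynomial.X)

/-- Saturation of a homogeneous ideal with respect to the irrelevant ideal. -/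
def saturate (I : Ideal (MvPolynomial (Fin (n+1)) K)) : Ideal (MvPolynomial (Fin (n+1)) K) :=
  ⨆ k : ℕ, Submodule.colon I ((irrelevantIdeal K n ^ k : Ideal (MvPolynomial (Fin (n+1)) K)) : Submodule (MvPolynomial (Fin (n+1)) K) (MvPolynomial (Fin (n+1)) K))

/-- `I` is the (saturated, homogeneous) ideal of a nonempty finite closed subscheme of
`ℙ^n`, i.e. its Hilbert function is eventually a positive constant. -/
structure IsFiniteSubscheme (I : Ideal (MvPolynomial (Fin (n+1)) K)) : Prop where
  homog : Ideal.IsHomogeneous (MvPolynomial.homogeneousSubmodule (Fin (n+1)) K) I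
  saturated : saturate I = I
  finite : ∃ d : ℕ, 0 < d ∧ ∀ᶠ m : ℕ in atTop, hilbF I m = d

/-- The degree (length) of the finite scheme with ideal `I` : the eventual value of
its Hilbert function. -/
def schemeDeg (I : Ideal (MvPolynomial (Fin (n+1)) K)) : ℕ :=
  if h : ∃ d : ℕ, ∀ᶠ m : ℕ in atTop, hilbF I m = d then h.choose else 0

/-- The Castelnuovo–Mumford regularity of the finite scheme with ideal `I` : the least
`p ≥ 1` such that the scheme is `(p-1)`-normal (for a finite scheme, `p`-regularity is
equivalent to `(p-1)`-normality). -/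
def schemeReg (I : Ideal (MvPolynomial (Fin (n+1)) K)) : ℕ :=
  sInf {p : ℕ | 1 ≤ p ∧ ∀ m : ℕ, p - 1 ≤ m → hilbF I m = schemeDeg I}

/-- `h¹(ℙ^n, I_Γ(q))` for a finite scheme `Γ` and `q ≥ 0`: the failure of `q`-normality,
`deg Γ - h_Γ(q)`. -/
def h1F (I : Ideal (MvPolynomial (Fin (n+1)) K)) (q : ℕ) : ℕ :=
  schemeDeg I - hilbF I q

/-- `J` is the ideal of a `t`-dimensional linear subspace of `ℙ^n`: it is generated by a
space of linear forms of codimension... i.e. of `K`-dimension `n - t`. -/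
def IsLinearSubspace (J : Ideal (MvPolynomial (Fin (n+1)) K)) (t : ℕ) : Prop :=
  ∃ W : Submodule K (MvPolynomial (Fin (n+1)) K),
    W ≤ MvPolynomial.homogeneousSubmodule (Fin (n+1)) K 1 ∧
    Module.finrank K W + t = n ∧
    J = Ideal.span (W : Set (MvPolynomial (Fin (n+1)) K))

/-- The ideal of the scheme-theoretic intersection (defined by the sum of the ideal
sheaves): the saturation of `I + J`. -/
def interIdeal (I J : Ideal (MvPolynomial (Fin (n+1)) K)) : Ideal (MvPolynomial (Fin (n+1)) K) :=
  saturate (I ⊔ J)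

/-- The residual scheme `Γ : V`, where `V` is the hypersurface `{f = 0}`, is defined by
the colon ideal `(I_Γ : f)`. -/
def residualIdeal (I : Ideal (MvPolynomial (Fin (n+1)) K)) (f : MvPolynomial (Fin (n+1)) K) :
    Ideal (MvPolynomial (Fin (n+1)) K) :=
  Submodule.colon I (Ideal.span {f})

/-- `Γ` admits a `(t+2)`-secant `t`-plane. -/
def HasSecantPlane (I : Ideal (MvPolynomial (Fin (n+1)) K)) (t : ℕ) : Prop :=
  ∃ J : Ideal (MvPolynomial (Fin (n+1)) K),
    IsLinearSubspace J t ∧ t + 2 ≤ schemeDeg (interIdeal I J)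

/-- `t(Γ)`: the smallest `t` such that `Γ` admits a `(t+2)`-secant `t`-plane. -/
def tInv (I : Ideal (MvPolynomial (Fin (n+1)) K)) : ℕ :=
  sInf {t : ℕ | HasSecantPlane I t}

/-- `Γ` is in linearly general position if `t(Γ) = n`. -/
def InLinGenPos (I : Ideal (MvPolynomial (Fin (n+1)) K)) : Prop :=
  tInv I = n

/-- `Γ ⊆ ℙ^n` is nondegenerate: `I(Γ)` contains no nonzero linear form. -/
def NondegenerateScheme (I : Ideal (MvPolynomial (Fin (n+1)) K)) : Prop :=
  Submodule.restrictScalars K I ⊓ MvPolynomial.homogeneousSubmodule (Fin (n+1)) K 1 = ⊥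

/-- The (projective) dimension of the linear span `⟨Γ⟩` of the scheme with ideal `I`:
`n` minus the number of independent linear forms in `I`. -/
def spanDim (I : Ideal (MvPolynomial (Fin (n+1)) K)) : ℕ :=
  n - Module.finrank K
    ↥(Submodule.restrictScalars K I ⊓ MvPolynomial.homogeneousSubmodule (Fin (n+1)) K 1)

/-- `Γ ∩ Λ` is nondegenerate as a subscheme of the `t`-plane `Λ`: it is contained in no
`(t-1)`-dimensional linear subspace of `Λ`. -/
def NondegenerateIn (I Λ : Ideal (MvPolynomial (Fin (n+1)) K)) (t : ℕ) : Prop :=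
  ∀ J : Ideal (MvPolynomial (Fin (n+1)) K),
    IsLinearSubspace J (t - 1) → Λ ≤ J → ¬ J ≤ interIdeal I Λ

/-- `Γ ∩ Λ` is in linearly general position as a subscheme of the `t`-plane `Λ`: it has
no `(s+2)`-secant `s`-plane inside `Λ` for any `s < t`. -/
def InLinGenPosIn (I Λ : Ideal (MvPolynomial (Fin (n+1)) K)) (t : ℕ) : Prop :=
  ∀ s : ℕ, s < t → ∀ J : Ideal (MvPolynomial (Fin (n+1)) K),
    IsLinearSubspace J s → Λ ≤ J → schemeDeg (interIdeal I J) ≤ s + 1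

/-- `J` is the (saturated) homogeneous ideal of a rational normal curve of degree `t`
in `ℙ^n` : the curve is the image of `ℙ^1` under a parametrization by a basis-spanning
family of binary forms of degree `t`, and `J` is the vanishing ideal of (the affine cone
over) this image. -/
def IsRNC (t : ℕ) (J : Ideal (MvPolynomial (Fin (n+1)) K)) : Prop :=
  ∃ p : Fin (n+1) → MvPolynomial (Fin 2) K,
    (∀ i, (p i).IsHomogeneous t) ∧
    Submodule.span K (Set.range p) = MvPolynomial.homogeneousSubmodule (Fin 2) K t ∧
    J = ⨅ x : Fin 2 → K,
      RingHom.ker (MvPolynomial.eval (fun i => MvPolynomial.eval x (p i)) :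
        MvPolynomial (Fin (n+1)) K →+* K)

/-- `ρ(Γ)`: the maximal length of the intersection of `Γ` with a rational normal curve
(of degree `n`) in `ℙ^n`. -/
def rhoInv (I : Ideal (MvPolynomial (Fin (n+1)) K)) : ℕ :=
  sSup {e : ℕ | ∃ J : Ideal (MvPolynomial (Fin (n+1)) K),
    IsRNC n J ∧ e = schemeDeg (interIdeal I J)}

/-- The (saturated homogeneous) vanishing ideal of a point of `ℙ^n`. -/
def pointIdeal (P : Projectivization K (Fin (n+1) → K)) : Ideal (MvPolynomial (Fin (n+1)) K) :=
  ⨅ c : K, RingHom.ker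
    (MvPolynomial.eval (c • P.rep) : MvPolynomial (Fin (n+1)) K →+* K)

/-- The vanishing ideal of a finite set of points of `ℙ^n`. -/
def idealOfFinset (S : Finset (Projectivization K (Fin (n+1) → K))) :
    Ideal (MvPolynomial (Fin (n+1)) K) :=
  ⨅ P ∈ S, pointIdeal P

/-- A finite set of points of `ℙ^n` is in uniform position if every subset `Y` has
Hilbert function `h_Y(ℓ) = min {|Y|, h_Γ(ℓ)}`. -/
def UniformPosition (S : Finset (Projectivization K (Fin (n+1) → K))) : Prop :=
  ∀ Y ⊆ S, ∀ ℓ : ℕ, hilbF (idealOfFinset Y) ℓ = min Y.card (hilbF (idealOfFinset S) ℓ)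

end

section ArtinianAlgebra

variable {K A : Type} [Field K] [CommRing A] [Algebra K A]

/-- An ideal of a `K`-algebra, viewed as a `K`-subspace. -/
abbrev idealSpace (K : Type) {A : Type} [Field K] [CommRing A] [Algebra K A] (a : Ideal A) :
    Submodule K A :=
  Submodule.restrictScalars K a

/-- The `K`-dimension of an ideal. -/
noncomputable abbrev idealDim (K : Type) {A : Type} [Field K] [CommRing A] [Algebra K A]
    (a : Ideal A) : ℕ :=
  Module.finrank K (idealSpace K a)

theorem finrank_map_add_finrank_inf_ker {E F : Type} [AddCommGroup E] [Module K E]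
    [AddCommGroup F] [Module K F] (g : E →ₗ[K] F) (p : Submodule K E) [FiniteDimensional K p] :
    Module.finrank K (p.map g) + Module.finrank K (p ⊓ LinearMap.ker g : Submodule K E) =
      Module.finrank K p := by
  have h := LinearMap.finrank_range_add_finrank_ker (g.domRestrict p)
  rw [LinearMap.range_domRestrict] at h
  have hker : LinearMap.ker (g.domRestrict p) =
      Submodule.comap p.subtype (p ⊓ LinearMap.ker g) := by
    ext x
    simp
  rw [← h, hker, LinearEquiv.finrank_eq
    (Submodule.comapSubtypeEquivOfLe (inf_le_left : p ⊓ LinearMap.ker g ≤ p))]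

theorem finrank_le_one_of_isSimpleModule [IsAlgClosed K] {Q : Type} [AddCommGroup Q] [Module K Q]
    [Module A Q] [IsScalarTower K A Q] [FiniteDimensional K Q] [IsSimpleModule A Q] :
    Module.finrank K Q ≤ 1 := by
  have := IsSimpleModule.nontrivial A Q
  obtain ⟨q, hq⟩ := exists_ne (0 : Q)
  refine finrank_le_one q fun w => ?_
  obtain ⟨x, hx⟩ := Submodule.mem_span_singleton.1
    ((IsSimpleModule.span_singleton_eq_top A hq).symm ▸ Submodule.mem_top :
      w ∈ Submodule.span A {q})
  obtain ⟨k, hk⟩ :=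
    (IsSimpleModule.algebraMap_end_bijective_of_isAlgClosed (A := A) (V := Q) K).2
      (LinearMap.lsmul A Q x)
  refine ⟨k, ?_⟩
  rw [← hx]
  simpa using LinearMap.congr_fun hk q

theorem finrank_le_finrank_inf_succ [IsAlgClosed K] {E : Type} [AddCommGroup E] [Module K E]
    [Module A E] [IsScalarTower K A E] [FiniteDimensional K E] (c : Submodule A E)
    (hc : IsSimpleModule A (E ⧸ c)) (W : Submodule K E) :
    Module.finrank K W ≤
      Module.finrank K (W ⊓ c.restrictScalars K : Submodule K E) + 1 := by
  have : FiniteDimensional K (E ⧸ c) :=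
    Module.Finite.of_surjective (c.mkQ.restrictScalars K) (Submodule.mkQ_surjective _)
  have h1 := finrank_map_add_finrank_inf_ker (c.mkQ.restrictScalars K) W
  have h2 := (Submodule.finrank_le (W.map (c.mkQ.restrictScalars K))).trans
    (finrank_le_one_of_isSimpleModule (A := A))
  have h3 : LinearMap.ker (c.mkQ.restrictScalars K) = c.restrictScalars K := by
    ext x
    simp
  rw [h3] at h1
  omega

/-- Between two ideals there is one of colength one in the larger ideal. -/
theorem exists_ideal_finrank_le_succ [IsAlgClosed K] [FiniteDimensional K A] {a b : Ideal A}
    (hab : a < b) :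
    ∃ c : Ideal A, a ≤ c ∧ c < b ∧ ∀ W : Submodule K A, W ≤ idealSpace K b →
      Module.finrank K W ≤ Module.finrank K (W ⊓ idealSpace K c : Submodule K A) + 1 := by
  have : IsNoetherianRing A := IsNoetherianRing.of_finite K A
  obtain ⟨c, hac, hcb⟩ := exists_le_covBy_of_lt hab
  refine ⟨c, hac, hcb.lt, fun W hW => ?_⟩
  have : FiniteDimensional K b := inferInstanceAs (FiniteDimensional K (idealSpace K b))
  have h := finrank_le_finrank_inf_succ (K := K) (Submodule.comap b.subtype c)
    ((covBy_iff_quot_is_simple hcb.le).1 hcb) (W.comap (b.subtype.restrictScalars K))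
  let ι : b →ₗ[K] A := b.subtype.restrictScalars K
  have hι : Function.Injective ι := Subtype.val_injective
  have h1 : (W.comap ι).map ι = W := by
    rw [Submodule.map_comap_eq, inf_eq_right]
    exact fun x hx => ⟨⟨x, hW hx⟩, rfl⟩
  have h2 : ((W.comap ι) ⊓ (Submodule.comap b.subtype c).restrictScalars K).map ι =
      W ⊓ idealSpace K c := by
    ext x
    constructor
    · rintro ⟨y, hy, rfl⟩
      exact hy
    · exact fun hx => ⟨⟨x, hW hx.1⟩, hx, rfl⟩
  have h3 := LinearEquiv.finrank_eq (Submodule.equivMapOfInjective ι hι (W.comap ι))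
  have h4 := LinearEquiv.finrank_eq (Submodule.equivMapOfInjective ι hι
    ((W.comap ι) ⊓ (Submodule.comap b.subtype c).restrictScalars K))
  rw [h1] at h3
  rw [h2] at h4
  rw [← h3, ← h4]
  exact h

theorem idealDim_mono [FiniteDimensional K A] {a b : Ideal A} (h : a ≤ b) :
    idealDim K a ≤ idealDim K b :=
  Submodule.finrank_mono (show idealSpace K a ≤ idealSpace K b from h)

theorem idealDim_strictMono [FiniteDimensional K A] {a b : Ideal A} (h : a < b) :
    idealDim K a < idealDim K b :=
  Submodule.finrank_lt_finrank_of_lt (show idealSpace K a < idealSpace K b from h)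

/-- Additivity of the length along a hypersurface section and its residual. -/
theorem idealDim_sup_span_add_idealDim_colon [FiniteDimensional K A] (a : Ideal A) (f : A) :
    idealDim K (a ⊔ Ideal.span {f}) + idealDim K (a.colon {f}) =
      Module.finrank K A + idealDim K a := by
  let g : A →ₗ[K] A ⧸ a := (Ideal.Quotient.mkₐ K a).toLinearMap ∘ₗ LinearMap.mulLeft K f
  have h1 := LinearMap.finrank_range_add_finrank_ker g
  have h2 := finrank_map_add_finrank_inf_ker (Ideal.Quotient.mkₐ K a).toLinearMap
    (idealSpace K (a ⊔ Ideal.span {f}))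
  have hker : LinearMap.ker g = idealSpace K (a.colon {f}) := by
    ext x
    simp only [LinearMap.mem_ker, g, LinearMap.comp_apply, LinearMap.mulLeft_apply,
      AlgHom.toLinearMap_apply, Ideal.Quotient.mkₐ_eq_mk, Ideal.Quotient.eq_zero_iff_mem,
      Submodule.restrictScalars_mem, Submodule.mem_colon_singleton, smul_eq_mul, mul_comm]
  have hinf : idealSpace K (a ⊔ Ideal.span {f}) ⊓
      LinearMap.ker (Ideal.Quotient.mkₐ K a).toLinearMap = idealSpace K a := by
    ext x
    simp only [Submodule.mem_inf, LinearMap.mem_ker, AlgHom.toLinearMap_apply,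
      Ideal.Quotient.mkₐ_eq_mk, Ideal.Quotient.eq_zero_iff_mem, Submodule.restrictScalars_mem]
    exact ⟨fun h => h.2, fun h => ⟨(le_sup_left : a ≤ a ⊔ Ideal.span {f}) h, h⟩⟩
  have hrange : (idealSpace K (a ⊔ Ideal.span {f})).map (Ideal.Quotient.mkₐ K a).toLinearMap =
      LinearMap.range g := by
    ext y
    simp only [Submodule.mem_map, Submodule.restrictScalars_mem, LinearMap.mem_range,
      AlgHom.toLinearMap_apply, Ideal.Quotient.mkₐ_eq_mk, g, LinearMap.comp_apply,
      LinearMap.mulLeft_apply]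
    constructor
    · rintro ⟨x, hx, rfl⟩
      obtain ⟨u, hu, v, hv, rfl⟩ := Submodule.mem_sup.1 hx
      obtain ⟨w, rfl⟩ := Ideal.mem_span_singleton'.1 hv
      exact ⟨w, by rw [map_add, Ideal.Quotient.eq_zero_iff_mem.2 hu, zero_add, mul_comm]⟩
    · rintro ⟨x, rfl⟩
      exact ⟨f * x, (le_sup_right : Ideal.span {f} ≤ a ⊔ Ideal.span {f})
        (Ideal.mul_mem_right _ _ (Ideal.mem_span_singleton_self f)), rfl⟩
  rw [hinf, hrange] at h2
  rw [hker] at h1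
  simp only [idealDim] at *
  omega

variable {V : Submodule K A}

theorem pow_le_pow_of_one_mem (h1 : (1 : A) ∈ V) {i j : ℕ} (hij : i ≤ j) : V ^ i ≤ V ^ j :=
  pow_le_pow_right' (Submodule.one_le.2 h1) hij

/-- If a section by `f ∈ V` is `(q+1)`-normal and the residual is `q`-normal, then the whole
scheme is `(q+1)`-normal. -/
theorem pow_succ_sup_eq_top {a : Ideal A} {f : A} (hf : f ∈ V) {q : ℕ}
    (hsec : V ^ (q + 1) ⊔ idealSpace K (a ⊔ Ideal.span {f}) = ⊤)
    (hres : V ^ q ⊔ idealSpace K (a.colon {f}) = ⊤) :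
    V ^ (q + 1) ⊔ idealSpace K a = ⊤ := by
  rw [eq_top_iff, ← hsec]
  refine sup_le le_sup_left fun x hx => ?_
  obtain ⟨u, hu, v, hv, rfl⟩ := Submodule.mem_sup.1 (show x ∈ a ⊔ Ideal.span {f} from hx)
  obtain ⟨w, rfl⟩ := Ideal.mem_span_singleton'.1 hv
  obtain ⟨y, hy, z, hz, rfl⟩ := Submodule.mem_sup.1 (hres.symm ▸ Submodule.mem_top : w ∈ _)
  rw [add_mul]
  refine add_mem (Submodule.mem_sup_right hu) (add_mem (Submodule.mem_sup_left ?_)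
    (Submodule.mem_sup_right ?_))
  · rw [pow_succ]
    exact Submodule.mul_mem_mul hy hf
  · exact Submodule.mem_colon_singleton.1 hz

/-- The dimension of the space of elements of `V` lying in an ideal. -/
noncomputable abbrev linDim (V : Submodule K A) (a : Ideal A) : ℕ :=
  Module.finrank K (V ⊓ idealSpace K a : Submodule K A)

theorem linDim_eq_of_le {a : Ideal A} (h : V ≤ idealSpace K a) :
    linDim V a = Module.finrank K V := by
  rw [linDim, inf_eq_left.2 h]

theorem idealDim_bot : idealDim K (⊥ : Ideal A) = 0 :=
  finrank_bot K A

theorem linDim_bot : linDim V (⊥ : Ideal A) = 0 := by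
  rw [linDim, show idealSpace K (⊥ : Ideal A) = ⊥ from rfl, inf_bot_eq, finrank_bot]

theorem finrank_add_idealDim_le [FiniteDimensional K A] (V : Submodule K A) (a : Ideal A) :
    Module.finrank K V + idealDim K a ≤ Module.finrank K A + linDim V a := by
  have h := Submodule.finrank_sup_add_finrank_inf_eq V (idealSpace K a)
  have h' := Submodule.finrank_le (V ⊔ idealSpace K a)
  simp only [idealDim, linDim] at *
  omega

theorem sup_eq_top_of_finrank_le [FiniteDimensional K A] {a : Ideal A}
    (h : Module.finrank K A + linDim V a ≤ Module.finrank K V + idealDim K a) :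
    V ⊔ idealSpace K a = ⊤ := by
  have h' := Submodule.finrank_sup_add_finrank_inf_eq V (idealSpace K a)
  apply Submodule.eq_top_of_finrank_eq
  have h'' := Submodule.finrank_le (V ⊔ idealSpace K a)
  simp only [idealDim, linDim] at *
  omega

/-- A scheme of length at most one is `0`-normal. -/
theorem one_sup_eq_top [FiniteDimensional K A] {a : Ideal A}
    (h : Module.finrank K A ≤ idealDim K a + 1) :
    (1 : Submodule K A) ⊔ idealSpace K a = ⊤ := by
  by_cases ha : a = ⊤
  · subst ha
    rw [eq_top_iff]
    exact fun x _ => Submodule.mem_sup_right (show x ∈ (⊤ : Ideal A) from trivial)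
  · have hlt : idealSpace K a < 1 ⊔ idealSpace K a := by
      refine lt_of_le_of_ne le_sup_right fun he => ha ?_
      rw [Ideal.eq_top_iff_one]
      have : (1 : A) ∈ idealSpace K a := by
        rw [he]
        exact Submodule.mem_sup_left (Submodule.one_le.1 le_rfl)
      exact this
    have := Submodule.finrank_lt_finrank_of_lt hlt
    apply Submodule.eq_top_of_finrank_eq
    have h'' := Submodule.finrank_le ((1 : Submodule K A) ⊔ idealSpace K a)
    simp only [idealDim] at *
    omega

/-- A maximal hyperplane section of a scheme spans the hyperplane. -/
theorem exists_maximal_section [IsAlgClosed K] [FiniteDimensional K A] {a : Ideal A}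
    (ha : ¬ V ≤ idealSpace K a) :
    ∃ f ∈ V, f ∉ a ∧ linDim V (a ⊔ Ideal.span {f}) ≤ linDim V a + 1 ∧
      ∀ g ∈ V, g ∉ a → idealDim K (a ⊔ Ideal.span {f}) ≤ idealDim K (a ⊔ Ideal.span {g}) := by
  obtain ⟨f₀, hf₀, hf₀a⟩ := Set.not_subset.1 ha
  obtain ⟨f, ⟨hfV, hfa⟩, hmin⟩ := exists_minimalFor_of_wellFoundedLT
    (fun g : A => g ∈ V ∧ g ∉ a) (fun g => idealDim K (a ⊔ Ideal.span {g})) ⟨f₀, hf₀, hf₀a⟩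
  have hmin' : ∀ g ∈ V, g ∉ a →
      idealDim K (a ⊔ Ideal.span {f}) ≤ idealDim K (a ⊔ Ideal.span {g}) := fun g hg hga =>
    (le_total _ _).elim id (hmin ⟨hg, hga⟩)
  refine ⟨f, hfV, hfa, ?_, hmin'⟩
  have hlt : a < a ⊔ Ideal.span {f} :=
    lt_of_le_of_ne le_sup_left fun he => hfa (he ▸ (le_sup_right : Ideal.span {f} ≤ _)
      (Ideal.mem_span_singleton_self f))
  obtain ⟨c, hac, hcb, hc⟩ := exists_ideal_finrank_le_succ (K := K) hlt
  have h1 := hc (V ⊓ idealSpace K (a ⊔ Ideal.span {f})) inf_le_right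
  have h2 : (V ⊓ idealSpace K (a ⊔ Ideal.span {f})) ⊓ idealSpace K c ≤ V ⊓ idealSpace K a := by
    rintro g ⟨⟨hgV, -⟩, hgc⟩
    refine ⟨hgV, ?_⟩
    by_contra hga
    have h3 := idealDim_strictMono (K := K) hcb
    have h4 := hmin' g hgV hga
    have h5 : a ⊔ Ideal.span {g} ≤ c :=
      sup_le hac ((Ideal.span_singleton_le_iff_mem c).2 hgc)
    have h6 := idealDim_mono (K := K) h5
    omega
  have h3 := Submodule.finrank_mono h2
  simp only [linDim] at *
  omega

/-- A linear section by a `w`-codimensional subspace extends to a hyperplane section which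
is longer by at least `w - 1`. -/
theorem exists_section_of_linear_section [IsAlgClosed K] [FiniteDimensional K A] (w : ℕ) :
    ∀ W : Submodule K A, w + 1 ≤ Module.finrank K W →
      ∃ f ∈ W, f ≠ 0 ∧ idealDim K (Ideal.span {f}) + w ≤ idealDim K (Ideal.span (W : Set A)) := by
  induction w with
  | zero =>
    intro W hW
    obtain ⟨f, hf, hf0⟩ := Submodule.exists_mem_ne_zero_of_ne_bot
      (Submodule.one_le_finrank_iff.1 hW)
    exact ⟨f, hf, hf0, idealDim_mono (Ideal.span_mono (Set.singleton_subset_iff.2 hf))⟩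
  | succ w ih =>
    intro W hW
    obtain ⟨f, hf, hf0⟩ := Submodule.exists_mem_ne_zero_of_ne_bot
      (Submodule.one_le_finrank_iff.1 (by omega : 1 ≤ Module.finrank K W))
    have hlt : (⊥ : Ideal A) < Ideal.span (W : Set A) :=
      bot_lt_iff_ne_bot.2 fun he => hf0 (by
        simpa [he] using (Ideal.subset_span hf : f ∈ Ideal.span (W : Set A)))
    obtain ⟨c, -, hcb, hc⟩ := exists_ideal_finrank_le_succ (K := K) hlt
    have h1 := hc W Ideal.subset_span
    obtain ⟨g, hg, hg0, hgd⟩ := ih (W ⊓ idealSpace K c) (by omega)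
    refine ⟨g, hg.1, hg0, ?_⟩
    have h2 : Ideal.span ((W ⊓ idealSpace K c : Submodule K A) : Set A) ≤ c :=
      Ideal.span_le.2 fun x hx => hx.2
    have h3 := idealDim_mono (K := K) h2
    have h4 := idealDim_strictMono (K := K) hcb
    omega

/-- No linear subspace of dimension `s < t` contains a subscheme of length `s + 2`. -/
def NoSecantBelow (V : Submodule K A) (t : ℕ) : Prop :=
  ∀ W ≤ V, Module.finrank K V ≤ Module.finrank K W + t →
    Module.finrank K A + Module.finrank K W ≤
      idealDim K (Ideal.span (W : Set A)) + Module.finrank K V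

theorem NoSecantBelow.le_of_linDim [FiniteDimensional K A] {t : ℕ} (hV : NoSecantBelow V t)
    {a : Ideal A} (h : Module.finrank K V ≤ linDim V a + t) :
    Module.finrank K A + linDim V a ≤ Module.finrank K V + idealDim K a := by
  have h1 := hV (V ⊓ idealSpace K a) inf_le_left h
  have h2 : Ideal.span ((V ⊓ idealSpace K a : Submodule K A) : Set A) ≤ a :=
    Ideal.span_le.2 fun x hx => hx.2
  have h3 := idealDim_mono (K := K) h2
  simp only [linDim] at *
  omega

/-- The regularity bound `⌈(d - k - 1) / t⌉ + 2`, for the subscheme defined by `a`. -/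
theorem NoSecantBelow.pow_succ_sup_eq_top_of_le [IsAlgClosed K] [FiniteDimensional K A]
    (h1 : (1 : A) ∈ V) {t : ℕ} (ht : 1 ≤ t) (hV : NoSecantBelow V t) (N : ℕ) :
    ∀ (a : Ideal A) (q : ℕ), Module.finrank K A ≤ idealDim K a + N →
      Module.finrank K A + linDim V a ≤ idealDim K a + Module.finrank K V + t * q →
      V ^ (q + 1) ⊔ idealSpace K a = ⊤ := by
  induction N with
  | zero =>
    intro a q hN _
    have : idealSpace K a = ⊤ := Submodule.eq_top_of_finrank_eq
      (le_antisymm (Submodule.finrank_le _) (by simpa using hN))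
    rw [this, sup_top_eq]
  | succ N ih =>
    intro a q hN hq
    by_cases hspan : Module.finrank K V ≤ linDim V a + t
    · have h := sup_eq_top_of_finrank_le (hV.le_of_linDim hspan)
      rw [eq_top_iff, ← h]
      refine sup_le_sup_right ?_ _
      simpa using pow_le_pow_of_one_mem h1 (by omega : 1 ≤ q + 1)
    · have hVa : ¬ V ≤ idealSpace K a := fun h => hspan (by
        have := linDim_eq_of_le h
        omega)
      obtain ⟨f, hfV, hfa, hlin, -⟩ := exists_maximal_section (K := K) hVa
      have hlt : a < a ⊔ Ideal.span {f} :=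
        lt_of_le_of_ne le_sup_left fun he => hfa (he ▸ (le_sup_right : Ideal.span {f} ≤ _)
          (Ideal.mem_span_singleton_self f))
      have hdim := idealDim_strictMono (K := K) hlt
      have hadd := idealDim_sup_span_add_idealDim_colon (K := K) a f
      have hsec := finrank_add_idealDim_le V (a ⊔ Ideal.span {f})
      have hle := Submodule.finrank_le (idealSpace K (a ⊔ Ideal.span {f}))
      refine pow_succ_sup_eq_top hfV (ih _ _ (by omega) (by omega)) ?_
      cases q with
      | zero =>
        rw [pow_zero]
        exact one_sup_eq_top (by simp only [mul_zero] at hq; omega)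
      | succ q =>
        rw [mul_add, mul_one] at hq
        refine ih _ _ (by omega) ?_
        by_cases hc : Module.finrank K V ≤ linDim V (a.colon {f}) + t
        · have := hV.le_of_linDim hc
          omega
        · omega

/-- A lower bound for the length of a subscheme that fails to be `p`-normal, in terms of a
bound `M` for the length of the hyperplane sections of the ambient scheme. -/
theorem NoSecantBelow.le_add_of_pow_sup_ne_top [IsAlgClosed K] [FiniteDimensional K A]
    (h1 : (1 : A) ∈ V) {t n M : ℕ} (ht : 1 ≤ t) (htn : t + 1 ≤ n)
    (hn : Module.finrank K V = n + 1) (hV : NoSecantBelow V t)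
    (hM : ∀ f ∈ V, f ≠ 0 → Module.finrank K A ≤ idealDim K (Ideal.span {f}) + M) (p : ℕ) :
    ∀ a : Ideal A, V ^ p ⊔ idealSpace K a ≠ ⊤ →
      idealDim K a + (t + 1) * p + 2 + n ≤ Module.finrank K A + M := by
  have hMn : n ≤ M := by
    obtain ⟨f, hf, hf0, hfd⟩ := exists_section_of_linear_section n V hn.ge
    have := hM f hf hf0
    have := Submodule.finrank_le (idealSpace K (Ideal.span (V : Set A)))
    simp only [idealDim] at *
    omega
  have hlinear : ∀ (b : Ideal A) (p : ℕ), 1 ≤ linDim V b → V ^ (p + 1) ⊔ idealSpace K b ≠ ⊤ →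
      idealDim K b + (t + 1) * (p + 1) + 2 + n ≤ Module.finrank K A + M := by
    intro b p hb hne
    have hd : idealDim K b + Module.finrank K V + t * p < Module.finrank K A + linDim V b := by
      by_contra h
      exact hne (hV.pow_succ_sup_eq_top_of_le h1 ht _ b p (Nat.le_add_left _ _) (by omega))
    have hspan : linDim V b + t < Module.finrank K V := by
      by_contra h
      have := hV.le_of_linDim (a := b) (by omega)
      omega
    obtain ⟨f, hf, hf0, hfd⟩ := exists_section_of_linear_section (linDim V b - 1)
      (V ⊓ idealSpace K b) (by simp only [linDim] at *; omega)
    have h2 := hM f hf.1 hf0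
    have h3 : Ideal.span ((V ⊓ idealSpace K b : Submodule K A) : Set A) ≤ b :=
      Ideal.span_le.2 fun x hx => hx.2
    have h4 := idealDim_mono (K := K) h3
    have h5 : (t + 1) * (p + 1) = t * p + t + p + 1 := by ring
    have h6 : p ≤ t * p := Nat.le_mul_of_pos_left p ht
    omega
  induction p with
  | zero =>
    intro a hne
    have : idealDim K a + 1 < Module.finrank K A := by
      by_contra h
      exact hne (by rw [pow_zero]; exact one_sup_eq_top (by omega))
    omega
  | succ p ih =>
    intro a hne
    by_cases ha : 1 ≤ linDim V a
    · exact hlinear a p ha hne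
    · have hVa : ¬ V ≤ idealSpace K a := fun h => ha (by
        have := linDim_eq_of_le h
        omega)
      obtain ⟨f, hfV, hfa, hlin, -⟩ := exists_maximal_section (K := K) hVa
      have hsec := finrank_add_idealDim_le V (a ⊔ Ideal.span {f})
      have hadd := idealDim_sup_span_add_idealDim_colon (K := K) a f
      have hmono := idealDim_mono (K := K) (le_sup_left : a ≤ a ⊔ Ideal.span {f})
      by_cases hb : V ^ (p + 1) ⊔ idealSpace K (a ⊔ Ideal.span {f}) = ⊤
      · have hres := ih (a.colon {f}) fun h => hne (pow_succ_sup_eq_top hfV hb h)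
        have h5 : (t + 1) * (p + 1) = (t + 1) * p + t + 1 := by ring
        omega
      · have hfb : 1 ≤ linDim V (a ⊔ Ideal.span {f}) := by
          refine Submodule.one_le_finrank_iff.2 fun h => hfa ?_
          have : f ∈ V ⊓ idealSpace K (a ⊔ Ideal.span {f}) :=
            ⟨hfV, (le_sup_right : Ideal.span {f} ≤ a ⊔ Ideal.span {f})
              (Ideal.mem_span_singleton_self f)⟩
          rw [h, Submodule.mem_bot] at this
          exact this ▸ zero_mem a
        have := hlinear _ p hfb hb
        omega

/-- Existence of a regularity preserving hyperplane section which spans the hyperplane. -/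
theorem NoSecantBelow.exists_section [IsAlgClosed K] [FiniteDimensional K A]
    (h1 : (1 : A) ∈ V) {t n q : ℕ} (ht : 1 ≤ t) (htn : t + 1 ≤ n)
    (hn : Module.finrank K V = n + 1) (hV : NoSecantBelow V t)
    (hq : Module.finrank K A ≤ (t + 1) * q + n + 1) (hne : V ^ (q + 1) ≠ ⊤) :
    ∃ f ∈ V, f ≠ 0 ∧ linDim V (Ideal.span {f}) ≤ 1 ∧
      V ^ (q + 1) ⊔ idealSpace K (Ideal.span {f}) ≠ ⊤ := by
  have hbot : idealSpace K (⊥ : Ideal A) = ⊥ := rfl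
  have hVb : ¬ V ≤ idealSpace K (⊥ : Ideal A) := fun h => by
    rw [hbot, le_bot_iff] at h
    rw [h, finrank_bot] at hn
    omega
  obtain ⟨f, hfV, hf0, hlin, hmax⟩ := exists_maximal_section (K := K) hVb
  simp only [bot_sup_eq, Ideal.mem_bot] at hf0 hlin hmax
  refine ⟨f, hfV, hf0, ?_, fun h => ?_⟩
  · rwa [linDim_bot, zero_add] at hlin
  · have hle := Submodule.finrank_le (idealSpace K (Ideal.span {f}))
    have hadd := idealDim_sup_span_add_idealDim_colon (K := K) (⊥ : Ideal A) f
    rw [bot_sup_eq, idealDim_bot] at hadd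
    have hres := hV.le_add_of_pow_sup_ne_top h1 (n := n)
      (M := Module.finrank K A - idealDim K (Ideal.span {f})) ht htn hn
      (fun g hg hg0 => by have := hmax g hg hg0; omega) q ((⊥ : Ideal A).colon {f})
      (fun hc => hne (by
        have := pow_succ_sup_eq_top (a := (⊥ : Ideal A)) hfV (by rwa [bot_sup_eq]) hc
        rwa [hbot, sup_bot_eq] at this))
    simp only [idealDim] at *
    omega

end ArtinianAlgebra

section Dehomogenization

variable {K : Type} [Field K] {n : ℕ}

instance finiteDimensional_homogeneousSubmodule (m : ℕ) :
    FiniteDimensional K (homogeneousSubmodule (Fin (n+1)) K m) :=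
  Module.Finite.iff_fg.2 (homogeneousSubmodule_fg (Fin (n+1)) K m)

theorem irrelevantIdeal_pow_le_span (N : ℕ) :
    irrelevantIdeal K n ^ N ≤
      Ideal.span (homogeneousSubmodule (Fin (n+1)) K N : Set (MvPolynomial (Fin (n+1)) K)) := by
  induction N with
  | zero =>
    rw [pow_zero, Ideal.one_eq_top, top_le_iff, Ideal.eq_top_iff_one]
    exact Ideal.subset_span (isHomogeneous_one _ _)
  | succ N ih =>
    rw [pow_succ]
    refine (Ideal.mul_mono_left ih).trans ?_
    rw [irrelevantIdeal, Ideal.span_mul_span']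
    refine Ideal.span_mono ?_
    rintro _ ⟨x, hx, _, ⟨i, rfl⟩, rfl⟩
    exact IsHomogeneous.mul hx (isHomogeneous_X K i)

theorem pow_mem_irrelevantIdeal_pow {l : MvPolynomial (Fin (n+1)) K} (hl : l.IsHomogeneous 1)
    (k : ℕ) : l ^ k ∈ irrelevantIdeal K n ^ k := by
  refine Ideal.pow_mem_pow ?_ k
  have h : l ∈ homogeneousSubmodule (Fin (n+1)) K 1 := hl
  rw [homogeneousSubmodule_one_eq_span_X] at h
  exact Submodule.span_le_restrictScalars K (MvPolynomial (Fin (n+1)) K) _ h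

/-- A finite subscheme is missed by some hyperplane. -/
theorem exists_linear_form_mul_mem_imp_mem [Infinite K] {I : Ideal (MvPolynomial (Fin (n+1)) K)}
    (hI : saturate I = I) :
    ∃ l : MvPolynomial (Fin (n+1)) K, l.IsHomogeneous 1 ∧ ∀ x, l * x ∈ I → x ∈ I := by
  by_contra! hcon
  let R := MvPolynomial (Fin (n+1)) K
  have hfin := associatedPrimes.finite R (R ⧸ I)
  let tr : Ideal R → Submodule K (homogeneousSubmodule (Fin (n+1)) K 1) := fun p =>
    (p.restrictScalars K).comap (homogeneousSubmodule (Fin (n+1)) K 1).subtype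
  refine Subspace.biUnion_ne_univ_of_top_notMem (s := hfin.toFinset.image tr) ?_ ?_
  · intro htop
    obtain ⟨p, hp, hptop⟩ := Finset.mem_image.1 htop
    obtain ⟨hprime, x, hx⟩ := isAssociatedPrime_iff.1 (hfin.mem_toFinset.1 hp)
    obtain ⟨y, rfl⟩ := Ideal.Quotient.mk_surjective x
    have hX : ∀ z ∈ irrelevantIdeal K n, z ∈ p := fun z hz => by
      refine (Ideal.span_le.2 ?_ : irrelevantIdeal K n ≤ p) hz
      rintro _ ⟨i, rfl⟩
      have : (⟨X i, isHomogeneous_X K i⟩ : homogeneousSubmodule (Fin (n+1)) K 1) ∈ tr p :=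
        hptop ▸ Submodule.mem_top
      exact this
    have hy : y ∈ I := by
      rw [← hI]
      refine (le_iSup (fun k : ℕ => Submodule.colon I
        ((irrelevantIdeal K n ^ k : Ideal R) : Set R)) 1) ?_
      rw [Submodule.mem_colon]
      intro z hz
      rw [SetLike.mem_coe, pow_one] at hz
      have h := hX z hz
      rw [hx, Submodule.mem_colon_singleton, Submodule.mem_bot] at h
      rw [smul_eq_mul, mul_comm]
      exact Ideal.Quotient.eq_zero_iff_mem.1 h
    refine hprime.ne_top ?_
    rw [hx, Ideal.Quotient.eq_zero_iff_mem.2 hy, Ideal.eq_top_iff_one,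
      Submodule.mem_colon_singleton]
    simp
  · rw [Set.eq_univ_iff_forall]
    rintro ⟨l, hl⟩
    obtain ⟨x, hx, hxI⟩ := hcon l hl
    have h : l ∈ ⋃ p ∈ associatedPrimes R (R ⧸ I), (p : Set R) := by
      rw [biUnion_associatedPrimes_eq_compl_regular]
      intro hreg
      refine hxI (Ideal.Quotient.eq_zero_iff_mem.1 (hreg ?_))
      exact (Ideal.Quotient.eq_zero_iff_mem.2 hx).trans (smul_zero l).symm
    simp only [Set.mem_iUnion] at h ⊢
    obtain ⟨p, hp, hlp⟩ := h
    exact ⟨tr p, Finset.mem_image_of_mem _ (hfin.mem_toFinset.2 hp), hlp⟩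

theorem irrelevantIdeal_pow_le_sup_span {I : Ideal (MvPolynomial (Fin (n+1)) K)}
    (hI : IsFiniteSubscheme I) {l : MvPolynomial (Fin (n+1)) K} (hl : l.IsHomogeneous 1)
    (hreg : ∀ x, l * x ∈ I → x ∈ I) :
    ∃ N : ℕ, irrelevantIdeal K n ^ N ≤ I ⊔ Ideal.span {l} := by
  obtain ⟨d, -, hd⟩ := hI.finite
  obtain ⟨N, hN⟩ := eventually_atTop.1 hd
  refine ⟨N + 1, (irrelevantIdeal_pow_le_span (N + 1)).trans (Ideal.span_le.2 fun x hx => ?_)⟩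
  let π := (Ideal.Quotient.mkₐ K I).toLinearMap
  let H := homogeneousSubmodule (Fin (n+1)) K
  let μ := LinearMap.mulLeft K (Ideal.Quotient.mkₐ K I l)
  have hle : ((H N).map π).map μ ≤ (H (N + 1)).map π := by
    rintro _ ⟨_, ⟨y, hy, rfl⟩, rfl⟩
    refine ⟨l * y, ?_, map_mul (Ideal.Quotient.mkₐ K I) l y⟩
    have := IsHomogeneous.mul hl hy
    rwa [add_comm 1 N] at this
  have hker : LinearMap.ker μ = ⊥ := by
    rw [LinearMap.ker_eq_bot']
    intro y hy
    obtain ⟨y, rfl⟩ := Ideal.Quotient.mk_surjective y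
    refine Ideal.Quotient.eq_zero_iff_mem.2 (hreg y (Ideal.Quotient.eq_zero_iff_mem.1 ?_))
    rw [map_mul]
    exact hy
  have heq := Submodule.eq_of_le_of_finrank_eq hle (by
    rw [← LinearEquiv.finrank_eq (Submodule.equivMapOfInjective μ
      (LinearMap.ker_eq_bot.1 hker) _)]
    exact (hN N le_rfl).trans (hN (N + 1) (Nat.le_succ N)).symm)
  obtain ⟨_, ⟨y, hy, rfl⟩, hxy⟩ := heq.symm ▸ Submodule.mem_map_of_mem (f := π) hx
  have hsub : x - l * y ∈ I := by
    rw [← Ideal.Quotient.eq_zero_iff_mem, map_sub, map_mul, sub_eq_zero]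
    exact hxy.symm
  rw [← sub_add_cancel x (l * y)]
  exact add_mem (Ideal.mem_sup_left hsub) (Ideal.mem_sup_right
    (Ideal.mul_mem_right _ _ (Ideal.mem_span_singleton_self l)))

theorem exists_pow_mul_mem_of_mem_sup {J : Ideal (MvPolynomial (Fin (n+1)) K)}
    (hJ : Ideal.IsHomogeneous (homogeneousSubmodule (Fin (n+1)) K) J)
    {l F : MvPolynomial (Fin (n+1)) K} (hl : l.IsHomogeneous 1) {m : ℕ} (hF : F.IsHomogeneous m)
    (hmem : F ∈ J ⊔ Ideal.span {l - 1}) : ∃ k : ℕ, l ^ k * F ∈ J := by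
  obtain ⟨g, hg, v, hv, hgv⟩ := Submodule.mem_sup.1 hmem
  obtain ⟨h, rfl⟩ := Ideal.mem_span_singleton'.1 hv
  let H := homogeneousSubmodule (Fin (n+1)) K
  let C : ℕ → MvPolynomial (Fin (n+1)) K → MvPolynomial (Fin (n+1)) K := fun j x =>
    DirectSum.decompose H x j
  have hCadd : ∀ j x y, C j (x + y) = C j x + C j y := fun j x y => by
    simp only [C, DirectSum.decompose_add, DirectSum.add_apply, Submodule.coe_add]
  have heq : g + l * h = F + h := by rw [← hgv]; ring
  have hC : ∀ j, C j g + C j (l * h) = C j F + C j h := fun j => by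
    rw [← hCadd, ← hCadd, heq]
  have hgJ : ∀ j, C j g ∈ J := fun j => hJ j hg
  have hC0 : C 0 (l * h) = 0 :=
    DirectSum.coe_decompose_mul_of_left_mem_of_not_le H (i := 1) hl (by omega)
  have hCs : ∀ j, C (j + 1) (l * h) = l * C j h := fun j =>
    DirectSum.coe_decompose_mul_of_left_mem_of_le H (i := 1) hl (by omega)
  have hFm : C m F = F := DirectSum.decompose_of_mem_same H hF
  have hFj : ∀ j, m ≠ j → C j F = 0 := fun j hj => DirectSum.decompose_of_mem_ne H hF hj
  have key : ∀ j, C j h + (if m ≤ j then l ^ (j - m) * F else 0) ∈ J := by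
    intro j
    induction j with
    | zero =>
      have h0 := hC 0
      rw [hC0, add_zero] at h0
      by_cases hm : m = 0
      · subst hm
        rw [hFm] at h0
        simp only [le_refl, if_true, Nat.sub_self, pow_zero, one_mul]
        rw [add_comm (C 0 h) F, ← h0]
        exact hgJ 0
      · rw [hFj 0 hm, zero_add] at h0
        rw [if_neg (by omega), add_zero, ← h0]
        exact hgJ 0
    | succ j ih =>
      have h1 := hC (j + 1)
      rw [hCs] at h1
      rcases lt_trichotomy m (j + 1) with hm | hm | hm
      · rw [hFj _ hm.ne, zero_add] at h1
        rw [if_pos (by omega)] at ih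
        rw [if_pos hm.le, ← h1, show j + 1 - m = (j - m) + 1 by omega, pow_succ]
        have : C (j + 1) g + l * C j h + l ^ (j - m) * l * F =
            C (j + 1) g + l * (C j h + l ^ (j - m) * F) := by ring
        rw [this]
        exact add_mem (hgJ _) (J.mul_mem_left _ ih)
      · rw [if_neg (by omega), add_zero] at ih
        rw [← hm, hFm] at h1
        rw [if_pos hm.le, ← hm, Nat.sub_self, pow_zero, one_mul, add_comm (C m h) F, ← h1]
        exact add_mem (hgJ _) (J.mul_mem_left _ ih)
      · rw [if_neg (by omega), add_zero] at ih
        rw [hFj _ hm.ne', zero_add] at h1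
        rw [if_neg (by omega), add_zero, ← h1]
        exact add_mem (hgJ _) (J.mul_mem_left _ ih)
  let T := m + (h.totalDegree + 1)
  have hT : C T h = 0 := by
    have : C T h = homogeneousComponent T h := decomposition.decompose'_apply h T
    rw [this]
    exact homogeneousComponent_eq_zero T h (by omega)
  have hfinal := key T
  rw [hT, zero_add, if_pos (Nat.le_add_right _ _)] at hfinal
  exact ⟨_, hfinal⟩

/-- `φ` restricts functions from `ℙ^n` to the finite scheme defined by `I`, after a linear form
not vanishing on it has been identified with `1`. -/
structure IsDehomogenization (I : Ideal (MvPolynomial (Fin (n+1)) K)) {A : Type} [CommRing A]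
    [Algebra K A] (φ : MvPolynomial (Fin (n+1)) K →ₐ[K] A) : Prop where
  surjective : Function.Surjective φ
  map_eq_bot : I.map φ = ⊥
  one_mem : (1 : A) ∈ (homogeneousSubmodule (Fin (n+1)) K 1).map φ.toLinearMap
  mem_saturate_iff : ∀ J : Ideal (MvPolynomial (Fin (n+1)) K), I ≤ J →
    Ideal.IsHomogeneous (homogeneousSubmodule (Fin (n+1)) K) J →
    ∀ (m : ℕ) (F : MvPolynomial (Fin (n+1)) K), F.IsHomogeneous m →
      (F ∈ saturate J ↔ φ F ∈ J.map φ)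

theorem exists_isDehomogenization [Infinite K] {I : Ideal (MvPolynomial (Fin (n+1)) K)}
    (hI : IsFiniteSubscheme I) :
    ∃ (A : Type) (_ : CommRing A) (_ : Algebra K A) (φ : MvPolynomial (Fin (n+1)) K →ₐ[K] A),
      IsDehomogenization I φ := by
  obtain ⟨l, hl, hreg⟩ := exists_linear_form_mul_mem_imp_mem hI.saturated
  obtain ⟨N, hN⟩ := irrelevantIdeal_pow_le_sup_span hI hl hreg
  let φ := Ideal.Quotient.mkₐ K (I ⊔ Ideal.span {l - 1})
  have hφ : ∀ x, φ x = 0 ↔ x ∈ I ⊔ Ideal.span {l - 1} := fun x =>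
    Ideal.Quotient.eq_zero_iff_mem
  have hφl : φ l = 1 := by
    rw [← sub_eq_zero, ← map_one φ, ← map_sub, hφ]
    exact Ideal.mem_sup_right (Ideal.mem_span_singleton_self _)
  have hsurj : Function.Surjective φ := Ideal.Quotient.mkₐ_surjective K _
  refine ⟨_, _, _, φ, hsurj, ?_, ⟨l, hl, hφl⟩, fun J hIJ hJ m F hF => ⟨fun h => ?_, fun h => ?_⟩⟩
  · rw [eq_bot_iff, Ideal.map_le_iff_le_comap]
    exact fun x hx => (hφ x).2 (Ideal.mem_sup_left hx)
  · refine (iSup_le fun k x hx => ?_ : saturate J ≤ (J.map φ).comap φ) h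
    have h1 := Ideal.mem_map_of_mem φ
      (Submodule.mem_colon.1 hx _ (pow_mem_irrelevantIdeal_pow hl k))
    rwa [smul_eq_mul, map_mul, map_pow, hφl, one_pow, mul_one] at h1
  · have h1 : F ∈ (J.map φ).comap φ := h
    rw [Ideal.comap_map_of_surjective φ hsurj] at h1
    have h2 : J ⊔ Ideal.comap φ ⊥ ≤ J ⊔ Ideal.span {l - 1} :=
      sup_le le_sup_left fun x hx =>
        (sup_le_sup_right hIJ _ : I ⊔ Ideal.span {l - 1} ≤ _) ((hφ x).1 hx)
    obtain ⟨k, hk⟩ := exists_pow_mul_mem_of_mem_sup hJ hl hF (h2 h1)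
    refine (le_iSup (fun k : ℕ => Submodule.colon J
      ((irrelevantIdeal K n ^ k : Ideal _) : Set _)) (N * (1 + k))) ?_
    rw [Submodule.mem_colon]
    intro z hz
    have hz' : z ∈ I ⊔ Ideal.span {l} ^ k := by
      have h3 := Ideal.pow_right_mono hN (1 + k)
      rw [← pow_mul] at h3
      simpa using Ideal.sup_pow_add_le_pow_sup_pow (h3 hz)
    rw [Ideal.span_singleton_pow] at hz'
    obtain ⟨u, hu, v, hv, rfl⟩ := Submodule.mem_sup.1 hz'
    obtain ⟨w, rfl⟩ := Ideal.mem_span_singleton'.1 hv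
    rw [smul_eq_mul, mul_add]
    refine add_mem (J.mul_mem_left _ (hIJ hu)) ?_
    rw [show F * (w * l ^ k) = w * (l ^ k * F) by ring]
    exact J.mul_mem_left _ hk

end Dehomogenization

section HilbertFunction

variable {K : Type} [Field K] {n : ℕ} {I : Ideal (MvPolynomial (Fin (n+1)) K)}
  {A : Type} [CommRing A] [Algebra K A] {φ : MvPolynomial (Fin (n+1)) K →ₐ[K] A}

/-- The image of the linear forms. -/
noncomputable abbrev linearImage (φ : MvPolynomial (Fin (n+1)) K →ₐ[K] A) : Submodule K A :=
  (homogeneousSubmodule (Fin (n+1)) K 1).map φ.toLinearMap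

theorem map_homogeneousSubmodule (φ : MvPolynomial (Fin (n+1)) K →ₐ[K] A) (m : ℕ) :
    (homogeneousSubmodule (Fin (n+1)) K m).map φ.toLinearMap = linearImage φ ^ m := by
  rw [linearImage, ← homogeneousSubmodule_one_pow, Submodule.map_pow]

theorem schemeDeg_eq {d : ℕ} (h : ∀ᶠ m : ℕ in atTop, hilbF I m = d) : schemeDeg I = d := by
  have hex : ∃ d : ℕ, ∀ᶠ m : ℕ in atTop, hilbF I m = d := ⟨d, h⟩
  rw [schemeDeg, dif_pos hex]
  obtain ⟨m, hm⟩ := (hex.choose_spec.and h).exists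
  exact hm.1.symm.trans hm.2

namespace IsDehomogenization

theorem hilbF_saturate_eq (D : IsDehomogenization I φ) {J : Ideal (MvPolynomial (Fin (n+1)) K)}
    (hIJ : I ≤ J) (hJ : Ideal.IsHomogeneous (homogeneousSubmodule (Fin (n+1)) K) J) (m : ℕ) :
    hilbF (saturate J) m = Module.finrank K ((linearImage φ ^ m).map
      (Ideal.Quotient.mkₐ K (J.map φ)).toLinearMap) := by
  let H := homogeneousSubmodule (Fin (n+1)) K m
  have h1 := finrank_map_add_finrank_inf_ker (Ideal.Quotient.mkₐ K (saturate J)).toLinearMap H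
  have h2 := finrank_map_add_finrank_inf_ker
    ((Ideal.Quotient.mkₐ K (J.map φ)).toLinearMap ∘ₗ φ.toLinearMap) H
  have h3 : H ⊓ LinearMap.ker (Ideal.Quotient.mkₐ K (saturate J)).toLinearMap =
      H ⊓ LinearMap.ker ((Ideal.Quotient.mkₐ K (J.map φ)).toLinearMap ∘ₗ φ.toLinearMap) := by
    ext F
    refine and_congr_right fun hF => ?_
    exact (Ideal.Quotient.eq_zero_iff_mem.trans (D.mem_saturate_iff J hIJ hJ m F hF)).trans
      Ideal.Quotient.eq_zero_iff_mem.symm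
  rw [h3] at h1
  rw [Submodule.map_comp, map_homogeneousSubmodule] at h2
  exact Nat.add_right_cancel (h1.trans h2.symm)

theorem exists_mem_linearImage_pow (D : IsDehomogenization I φ) (a : A) :
    ∃ m, a ∈ linearImage φ ^ m := by
  obtain ⟨F, rfl⟩ := D.surjective a
  refine ⟨F.totalDegree, ?_⟩
  nth_rw 2 [← F.sum_homogeneousComponent]
  rw [map_sum]
  refine Submodule.sum_mem _ fun i hi => ?_
  refine pow_le_pow_of_one_mem D.one_mem (Nat.lt_succ_iff.1 (Finset.mem_range.1 hi)) ?_
  rw [← map_homogeneousSubmodule]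
  exact Submodule.mem_map_of_mem (homogeneousComponent_isHomogeneous i F)

theorem hilbF_eq (D : IsDehomogenization I φ) (hI : IsFiniteSubscheme I) (m : ℕ) :
    hilbF I m = Module.finrank K ↥(linearImage φ ^ m) := by
  have h := D.hilbF_saturate_eq le_rfl hI.homog m
  rw [hI.saturated, D.map_eq_bot] at h
  rw [h]
  refine LinearEquiv.finrank_eq (Submodule.equivMapOfInjective _ ?_ _).symm
  intro x y hxy
  exact sub_eq_zero.1 (Ideal.mem_bot.1 (Ideal.Quotient.eq.1 hxy))

theorem exists_linearImage_pow_eq_top (D : IsDehomogenization I φ) (hI : IsFiniteSubscheme I) :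
    ∃ N, ∀ m, N ≤ m → linearImage φ ^ m = ⊤ := by
  obtain ⟨d, -, hd⟩ := hI.finite
  obtain ⟨N, hN⟩ := eventually_atTop.1 hd
  have hfd : ∀ m, FiniteDimensional K ↥(linearImage φ ^ m) := fun m => by
    rw [← map_homogeneousSubmodule]
    infer_instance
  have heq : ∀ m, N ≤ m → linearImage φ ^ N = linearImage φ ^ m := fun m hm =>
    Submodule.eq_of_le_of_finrank_eq (pow_le_pow_of_one_mem D.one_mem hm) (by
      rw [← D.hilbF_eq hI, ← D.hilbF_eq hI, hN N le_rfl, hN m hm])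
  have htop : linearImage φ ^ N = ⊤ := by
    refine eq_top_iff.2 fun a _ => ?_
    obtain ⟨m, hm⟩ := D.exists_mem_linearImage_pow a
    rw [heq _ (le_max_right m N)]
    exact pow_le_pow_of_one_mem D.one_mem (le_max_left m N) hm
  exact ⟨N, fun m hm => (heq m hm).symm.trans htop⟩

theorem finiteDimensional (D : IsDehomogenization I φ) (hI : IsFiniteSubscheme I) :
    FiniteDimensional K A := by
  obtain ⟨N, hN⟩ := D.exists_linearImage_pow_eq_top hI
  have h : (⊤ : Submodule K A).FG := by
    rw [← hN N le_rfl, ← map_homogeneousSubmodule]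
    exact (homogeneousSubmodule_fg (Fin (n+1)) K N).map _
  exact ⟨h⟩

variable [FiniteDimensional K A]

theorem hilbF_saturate_add (D : IsDehomogenization I φ) {J : Ideal (MvPolynomial (Fin (n+1)) K)}
    (hIJ : I ≤ J) (hJ : Ideal.IsHomogeneous (homogeneousSubmodule (Fin (n+1)) K) J) (m : ℕ) :
    hilbF (saturate J) m + idealDim K (J.map φ) =
      Module.finrank K ↥(linearImage φ ^ m ⊔ idealSpace K (J.map φ)) := by
  let π := (Ideal.Quotient.mkₐ K (J.map φ)).toLinearMap
  have hker : LinearMap.ker π = idealSpace K (J.map φ) := by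
    ext x
    exact Ideal.Quotient.eq_zero_iff_mem
  have h := finrank_map_add_finrank_inf_ker π (linearImage φ ^ m ⊔ LinearMap.ker π)
  rw [Submodule.map_sup, (LinearMap.le_ker_iff_map (f := π)).1 le_rfl, sup_bot_eq,
    inf_eq_right.2 le_sup_right, hker] at h
  rw [D.hilbF_saturate_eq hIJ hJ]
  exact h

theorem schemeDeg_saturate_add (D : IsDehomogenization I φ) (hI : IsFiniteSubscheme I)
    {J : Ideal (MvPolynomial (Fin (n+1)) K)}
    (hIJ : I ≤ J) (hJ : Ideal.IsHomogeneous (homogeneousSubmodule (Fin (n+1)) K) J) :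
    schemeDeg (saturate J) + idealDim K (J.map φ) = Module.finrank K A := by
  obtain ⟨N, hN⟩ := D.exists_linearImage_pow_eq_top hI
  have h : ∀ m, N ≤ m → hilbF (saturate J) m + idealDim K (J.map φ) = Module.finrank K A :=
    fun m hm => by rw [D.hilbF_saturate_add hIJ hJ, hN m hm, top_sup_eq, finrank_top]
  have hs : schemeDeg (saturate J) = hilbF (saturate J) N :=
    schemeDeg_eq (eventually_atTop.2 ⟨N, fun m hm =>
      Nat.add_right_cancel ((h m hm).trans (h N le_rfl).symm)⟩)
  rw [hs, h N le_rfl]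

theorem schemeDeg_eq_finrank (D : IsDehomogenization I φ) (hI : IsFiniteSubscheme I) :
    schemeDeg I = Module.finrank K A := by
  have h := D.schemeDeg_saturate_add hI le_rfl hI.homog
  rwa [hI.saturated, D.map_eq_bot, idealDim, idealSpace, Submodule.restrictScalars_bot,
    finrank_bot, add_zero] at h

theorem schemeReg_saturate (D : IsDehomogenization I φ) (hI : IsFiniteSubscheme I)
    {J : Ideal (MvPolynomial (Fin (n+1)) K)}
    (hIJ : I ≤ J) (hJ : Ideal.IsHomogeneous (homogeneousSubmodule (Fin (n+1)) K) J) :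
    schemeReg (saturate J) =
      sInf {p | 1 ≤ p ∧ linearImage φ ^ (p - 1) ⊔ idealSpace K (J.map φ) = ⊤} := by
  have hiff : ∀ m, hilbF (saturate J) m = schemeDeg (saturate J) ↔
      linearImage φ ^ m ⊔ idealSpace K (J.map φ) = ⊤ := fun m => by
    have h1 := D.hilbF_saturate_add hIJ hJ m
    have h2 := D.schemeDeg_saturate_add hI hIJ hJ
    constructor
    · intro h
      exact Submodule.eq_top_of_finrank_eq (by rw [← h1, ← h2, h])
    · intro h
      rw [h, finrank_top] at h1
      exact Nat.add_right_cancel (h1.trans h2.symm)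
  rw [schemeReg]
  congr 1
  ext p
  refine and_congr_right fun _ => ⟨fun h => (hiff _).1 (h _ le_rfl), fun h m hm => (hiff m).2 ?_⟩
  exact top_le_iff.1 (h.ge.trans (sup_le_sup_right (pow_le_pow_of_one_mem D.one_mem hm) _))

theorem schemeReg_eq (D : IsDehomogenization I φ) (hI : IsFiniteSubscheme I) :
    schemeReg I = sInf {p | 1 ≤ p ∧ linearImage φ ^ (p - 1) = ⊤} := by
  have h := D.schemeReg_saturate hI le_rfl hI.homog
  rw [hI.saturated, D.map_eq_bot] at h
  simpa [idealSpace] using h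

end IsDehomogenization

theorem isHomogeneous_sup_span
    (hI : Ideal.IsHomogeneous (homogeneousSubmodule (Fin (n+1)) K) I)
    {s : Set (MvPolynomial (Fin (n+1)) K)} (hs : ∀ x ∈ s, x.IsHomogeneous 1) :
    Ideal.IsHomogeneous (homogeneousSubmodule (Fin (n+1)) K) (I ⊔ Ideal.span s) :=
  hI.sup (Ideal.homogeneous_span _ _ fun x hx => ⟨1, hs x hx⟩)

theorem IsDehomogenization.map_sup_span (D : IsDehomogenization I φ)
    (s : Set (MvPolynomial (Fin (n+1)) K)) :
    (I ⊔ Ideal.span s).map φ = Ideal.span (φ '' s) := by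
  rw [Ideal.map_sup, D.map_eq_bot, bot_sup_eq, Ideal.map_span]

end HilbertFunction

section LinearForms

variable {K : Type} [Field K] {n : ℕ} {I : Ideal (MvPolynomial (Fin (n+1)) K)}
  {A : Type} [CommRing A] [Algebra K A] {φ : MvPolynomial (Fin (n+1)) K →ₐ[K] A}

theorem finrank_homogeneousSubmodule_one :
    Module.finrank K (homogeneousSubmodule (Fin (n+1)) K 1) = n + 1 := by
  have hX : LinearIndependent K (X : Fin (n+1) → MvPolynomial (Fin (n+1)) K) :=
    linearIndependent_X _ _
  rw [homogeneousSubmodule_one_eq_span_X, finrank_span_eq_card hX, Fintype.card_fin]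

namespace IsDehomogenization

theorem eq_zero_of_map_eq_zero (D : IsDehomogenization I φ) (hI : IsFiniteSubscheme I)
    (hnd : NondegenerateScheme I) {F : MvPolynomial (Fin (n+1)) K} (hF : F.IsHomogeneous 1)
    (h : φ F = 0) : F = 0 := by
  have hmem : F ∈ I := by
    rw [← hI.saturated, D.mem_saturate_iff I le_rfl hI.homog 1 F hF, h]
    exact zero_mem _
  have h2 : F ∈ Submodule.restrictScalars K I ⊓ homogeneousSubmodule (Fin (n+1)) K 1 :=
    ⟨hmem, hF⟩
  rw [hnd] at h2
  exact h2

theorem finrank_map_eq (D : IsDehomogenization I φ) (hI : IsFiniteSubscheme I)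
    (hnd : NondegenerateScheme I) {W : Submodule K (MvPolynomial (Fin (n+1)) K)}
    (hW : W ≤ homogeneousSubmodule (Fin (n+1)) K 1) :
    Module.finrank K (W.map φ.toLinearMap) = Module.finrank K W := by
  have : FiniteDimensional K W := Submodule.finiteDimensional_of_le hW
  have h := finrank_map_add_finrank_inf_ker φ.toLinearMap W
  have hbot : W ⊓ LinearMap.ker φ.toLinearMap = ⊥ :=
    eq_bot_iff.2 fun F hF => D.eq_zero_of_map_eq_zero hI hnd (hW hF.1) hF.2
  rwa [hbot, finrank_bot, add_zero] at h

theorem finrank_linearImage (D : IsDehomogenization I φ) (hI : IsFiniteSubscheme I)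
    (hnd : NondegenerateScheme I) : Module.finrank K (linearImage φ) = n + 1 := by
  rw [D.finrank_map_eq hI hnd le_rfl, finrank_homogeneousSubmodule_one]

theorem noSecantBelow (D : IsDehomogenization I φ) (hI : IsFiniteSubscheme I)
    (hnd : NondegenerateScheme I) [FiniteDimensional K A] :
    NoSecantBelow (linearImage φ) (tInv I) := by
  intro W hW hWt
  have hle := Submodule.finrank_mono hW
  rw [D.finrank_linearImage hI hnd] at hle hWt ⊢
  rcases hle.lt_or_eq with hlt | heq
  · obtain ⟨s, hs⟩ : ∃ s, Module.finrank K W + s = n := ⟨n - Module.finrank K W, by omega⟩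
    let U := homogeneousSubmodule (Fin (n+1)) K 1 ⊓ W.comap φ.toLinearMap
    have hU : U ≤ homogeneousSubmodule (Fin (n+1)) K 1 := inf_le_left
    have hUW : U.map φ.toLinearMap = W := by
      refine le_antisymm (Submodule.map_le_iff_le_comap.2 inf_le_right) fun w hw => ?_
      obtain ⟨F, hF, rfl⟩ := hW hw
      exact ⟨F, ⟨hF, hw⟩, rfl⟩
    have hsec : ¬ HasSecantPlane I s := Nat.notMem_of_lt_sInf (show s < tInv I by omega)
    have hdeg : schemeDeg (interIdeal I (Ideal.span (U : Set _))) < s + 2 := by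
      by_contra! hcon
      refine hsec ⟨_, ⟨U, hU, ?_, rfl⟩, hcon⟩
      rw [← D.finrank_map_eq hI hnd hU, hUW, hs]
    have hadd := D.schemeDeg_saturate_add hI le_sup_left
      (isHomogeneous_sup_span hI.homog (s := (U : Set _)) hU)
    rw [D.map_sup_span, show φ '' (U : Set _) = (W : Set A) by rw [← hUW]; rfl] at hadd
    rw [interIdeal] at hdeg
    omega
  · have hWV : W = linearImage φ :=
      Submodule.eq_of_le_of_finrank_eq hW (by rw [heq, D.finrank_linearImage hI hnd])
    have htop : Ideal.span (W : Set A) = ⊤ :=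
      (Ideal.eq_top_iff_one _).2 (Ideal.subset_span (hWV ▸ D.one_mem))
    rw [htop, heq, idealDim, idealSpace, Submodule.restrictScalars_top, finrank_top]

end IsDehomogenization

theorem one_le_tInv {d : ℕ} (hd : n + 1 ≤ d)
    (hlow : ⌈((d : ℚ) - n - 1) / ((tInv I : ℚ) + 1)⌉ + 3 ≤ (schemeReg I : ℤ))
    (hhigh : (schemeReg I : ℤ) ≤ ⌈((d : ℚ) - n - 1) / (tInv I : ℚ)⌉ + 2) : 1 ≤ tInv I := by
  by_contra! h
  have h0 : tInv I = 0 := by omega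
  have hd' : (n : ℚ) + 1 ≤ d := by exact_mod_cast hd
  have hpos : (0 : ℤ) ≤ ⌈((d : ℚ) - n - 1) / ((tInv I : ℚ) + 1)⌉ :=
    Int.ceil_nonneg (div_nonneg (by linarith) (by positivity))
  rw [h0, Nat.cast_zero, div_zero, Int.ceil_zero] at hhigh
  omega

theorem exists_schemeReg_eq_add_three {d t r : ℕ} (hd : n + 1 ≤ d)
    (hlow : ⌈((d : ℚ) - n - 1) / ((t : ℚ) + 1)⌉ + 3 ≤ (r : ℤ)) :
    ∃ q, r = q + 3 ∧ d ≤ (t + 1) * q + n + 1 := by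
  have hd' : (n : ℚ) + 1 ≤ d := by exact_mod_cast hd
  have ht : (0 : ℚ) < (t : ℚ) + 1 := by positivity
  have hpos : (0 : ℤ) ≤ ⌈((d : ℚ) - n - 1) / ((t : ℚ) + 1)⌉ :=
    Int.ceil_nonneg (div_nonneg (by linarith) ht.le)
  obtain ⟨q, rfl⟩ : ∃ q, r = q + 3 := ⟨r - 3, by omega⟩
  refine ⟨q, rfl, ?_⟩
  have h : ⌈((d : ℚ) - n - 1) / ((t : ℚ) + 1)⌉ ≤ (q : ℤ) := by push_cast at hlow; omega
  rw [Int.ceil_le, div_le_iff₀ ht] at h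
  have h2 : (d : ℚ) ≤ (t + 1) * q + n + 1 := by push_cast at h; linarith
  exact_mod_cast h2

end LinearForms

/-- Theorem 3.4: condition RPH. -/
theorem stmt10 (K : Type) [Field K] [IsAlgClosed K] [CharZero K] (n d : ℕ)
    (I : Ideal (MvPolynomial (Fin (n+1)) K))
    (hfin : IsFiniteSubscheme I) (hnd : NondegenerateScheme I)
    (hdeg : schemeDeg I = d)
    (ht : tInv I ≤ n - 1)
    (hlow : ⌈((d : ℚ) - n - 1) / ((tInv I : ℚ) + 1)⌉ + 3 ≤ (schemeReg I : ℤ))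
    (hhigh : (schemeReg I : ℤ) ≤ ⌈((d : ℚ) - n - 1) / (tInv I : ℚ)⌉ + 2) :
    ∃ f : MvPolynomial (Fin (n+1)) K, f ≠ 0 ∧ f.IsHomogeneous 1 ∧
      NondegenerateIn I (Ideal.span {f}) (n - 1) ∧
      schemeReg (interIdeal I (Ideal.span {f})) = schemeReg I := by
  obtain ⟨A, _, _, φ, D⟩ := exists_isDehomogenization hfin
  have := D.finiteDimensional hfin
  have hV := D.finrank_linearImage hfin hnd
  have hd : Module.finrank K A = d := (D.schemeDeg_eq_finrank hfin).symm.trans hdeg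
  have hnd' : n + 1 ≤ d := hV ▸ hd ▸ Submodule.finrank_le (linearImage φ)
  have ht1 := one_le_tInv hnd' hlow hhigh
  obtain ⟨q, hr, hq⟩ := exists_schemeReg_eq_add_three hnd' hlow
  have hreg := D.schemeReg_eq hfin
  have htop : linearImage φ ^ (q + 2) = ⊤ := by
    have hne : {p | 1 ≤ p ∧ linearImage φ ^ (p - 1) = ⊤}.Nonempty :=
      Nat.nonempty_of_pos_sInf (by omega)
    have h := (Nat.sInf_mem hne).2
    rwa [← hreg, hr] at h
  have hne : linearImage φ ^ (q + 1) ≠ ⊤ := fun h => by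
    have hlt : q + 2 < sInf {p | 1 ≤ p ∧ linearImage φ ^ (p - 1) = ⊤} := by omega
    exact Nat.notMem_of_lt_sInf hlt ⟨Nat.le_add_left 1 (q + 1), h⟩
  obtain ⟨_, ⟨F, hF, rfl⟩, hF0, hlin, hne'⟩ := NoSecantBelow.exists_section D.one_mem ht1
    (by omega) hV (D.noSecantBelow hfin hnd) (hd ▸ hq) hne
  have hFhom : ∀ x ∈ ({F} : Set (MvPolynomial (Fin (n+1)) K)), x.IsHomogeneous 1 :=
    fun x hx => Set.mem_singleton_iff.1 hx ▸ hF
  have hJ := isHomogeneous_sup_span hfin.homog hFhom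
  have hmap := D.map_sup_span {F}
  rw [Set.image_singleton] at hmap
  refine ⟨F, fun h => hF0 (by rw [h, map_zero]), hF, ?_, ?_⟩
  · rintro _ ⟨W, hW, hWn, rfl⟩ - hle
    have hsub : W.map φ.toLinearMap ≤
        linearImage φ ⊓ idealSpace K (Ideal.span {φ F}) := by
      refine le_inf (Submodule.map_mono hW) ?_
      rintro _ ⟨G, hG, rfl⟩
      have h := (D.mem_saturate_iff _ le_sup_left hJ 1 G (hW hG)).1 (hle (Ideal.subset_span hG))
      rwa [hmap] at h
    have h := (Submodule.finrank_mono hsub).trans hlin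
    rw [D.finrank_map_eq hfin hnd hW] at h
    omega
  · rw [interIdeal, D.schemeReg_saturate hfin le_sup_left hJ, hmap, hr]
    have hmem : q + 3 ∈ {p | 1 ≤ p ∧
        linearImage φ ^ (p - 1) ⊔ idealSpace K (Ideal.span {φ F}) = ⊤} :=
      ⟨Nat.le_add_left 1 (q + 2), (congrArg (· ⊔ _) htop).trans (top_sup_eq _)⟩
    refine le_antisymm (Nat.sInf_le hmem) (le_csInf ⟨_, hmem⟩ ?_)
    rintro p ⟨-, hp⟩
    by_contra! hlt
    refine hne' (top_le_iff.1 (hp.ge.trans (sup_le_sup_right ?_ _)))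
    exact pow_le_pow_of_one_mem D.one_mem (by omega)
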